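/- Let F be a field of characteristic different from two, and let p and q be anisotropic forms over F, where p is a neighbour of a Pfister form π over F. If q becomes hyperbolic over F(p), then q ≅ π ⊗ r for some form r over F. -/

import Mathlib

set_option synthInstance.maxHeartbeats 1000000
set_option maxHeartbeats 4000000

open scoped BigOperators Classical

namespace QF

section Defs

variable {R : Type*} [CommRing R]

/-- Evaluation of the diagonal quadratic form with coefficients `d` at the vector `v`. -/
def evalQF {n : ℕ} (d : Fin n → R) (v : Fin n → R) : R := ∑ i, d i * v i ^ 2

/-- A form is isotropic if it represents zero non-trivially. -/
def Isotropic {n : ℕ} (d : Fin n → R) : Prop := ∃ v : Fin n → R, v ≠ 0 ∧ evalQF d v = 0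

def Anisotropic {n : ℕ} (d : Fin n → R) : Prop := ¬ Isotropic d

/-- Nondegeneracy of a diagonal form: all coefficients are nonzero. -/
def Nondeg {n : ℕ} (d : Fin n → R) : Prop := ∀ i, d i ≠ 0

/-- Two diagonal forms are isometric if a linear equivalence matches their values. -/
def Isometric {m n : ℕ} (d : Fin m → R) (e : Fin n → R) : Prop :=
  ∃ φ : (Fin m → R) ≃ₗ[R] (Fin n → R), ∀ v, evalQF e (φ v) = evalQF d v

/-- Orthogonal sum of diagonal forms. -/
def osum {m n : ℕ} (d : Fin m → R) (e : Fin n → R) : Fin (m + n) → R := Fin.append d e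

/-- Tensor product of diagonal forms. -/
def tensorQF {m n : ℕ} (d : Fin m → R) (e : Fin n → R) : Fin (m * n) → R :=
  fun i => d (finProdFinEquiv.symm i).1 * e (finProdFinEquiv.symm i).2

/-- Scaling of a form by a scalar. -/
def smulQF {n : ℕ} (a : R) (d : Fin n → R) : Fin n → R := fun i => a * d i

/-- `k` copies of the hyperbolic plane `⟨1,-1⟩`. -/
def hypform {R : Type*} [CommRing R] (k : ℕ) : Fin (k + k) → R :=
  Fin.append (fun _ => 1) (fun _ => -1)

/-- A form is hyperbolic if it is isometric to a sum of hyperbolic planes,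
i.e. its Witt index is half its dimension. -/
def IsHyperbolic {n : ℕ} (d : Fin n → R) : Prop := ∃ k : ℕ, Isometric d (hypform k)

/-- The Witt index: the largest `k` such that `d ≅ k×⟨1,-1⟩ ⊥ r`. -/
noncomputable def WittIndex {n : ℕ} (d : Fin n → R) : ℕ :=
  sSup {k : ℕ | ∃ (m : ℕ) (r : Fin m → R), Isometric d (osum (hypform k) r)}

/-- `r` is a subform of `d`: `d ≅ r ⊥ s` for some (nondegenerate) form `s`. -/
def Subform {m n : ℕ} (r : Fin m → R) (d : Fin n → R) : Prop :=
  ∃ (k : ℕ) (s : Fin k → R), Nondeg s ∧ Isometric d (osum r s)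

/-- The set of nonzero represented values. -/
def Dset {n : ℕ} (d : Fin n → R) : Set R :=
  {a | a ≠ 0 ∧ ∃ v : Fin n → R, evalQF d v = a}

/-- The group of similarity factors `G(q) = {a : a·q ≅ q}`. -/
def Gset {n : ℕ} (d : Fin n → R) : Set R :=
  {a | a ≠ 0 ∧ Isometric (smulQF a d) d}

/-- `H(q) = {a : ⟨1,-a⟩ ⊗ q is isotropic}`. -/
def Hset {n : ℕ} (d : Fin n → R) : Set R :=
  {a | a ≠ 0 ∧ Isotropic (tensorQF ![1, -a] d)}

/-- Base change of a form along a ring homomorphism (e.g. a field extension). -/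
def bc {S : Type*} [CommRing S] (f : R →+* S) {n : ℕ} (d : Fin n → R) : Fin n → S :=
  fun i => f (d i)

/-- The Pfister form `⟨1,a 0⟩ ⊗ ⋯ ⊗ ⟨1, a (n-1)⟩`: its `2^n` diagonal coefficients are
the products `∏_{j ∈ S} a j` over subsets `S` of the index set. -/
noncomputable def pfisterOf {n : ℕ} (a : Fin n → R) : Fin (2 ^ n) → R :=
  fun i => ∏ j : Fin n, if (finFunctionFinEquiv.symm i) j = 0 then 1 else a j

/-- `π` is an `n`-fold Pfister form. -/
def IsNPfister (n : ℕ) {m : ℕ} (π : Fin m → R) : Prop :=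
  ∃ a : Fin n → R, (∀ i, a i ≠ 0) ∧ Isometric π (pfisterOf a)

/-- `π` is a Pfister form. -/
def IsPfister {m : ℕ} (π : Fin m → R) : Prop := ∃ n : ℕ, IsNPfister n π

end Defs

/-- The quadric polynomial `p(X₁,…,Xₙ) = ∑ dᵢ Xᵢ²` attached to a diagonal form. -/
noncomputable def formPoly {F : Type*} [CommRing F] {n : ℕ} (d : Fin n → F) :
    MvPolynomial (Fin n) F :=
  ∑ i, MvPolynomial.C (d i) * MvPolynomial.X i ^ 2

/-- The affine coordinate ring `F[X₁,…,Xₙ]/(p(X))` of the quadric `p = 0`. -/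
abbrev CoordRing {F : Type*} [CommRing F] {n : ℕ} (d : Fin n → F) : Type _ :=
  MvPolynomial (Fin n) F ⧸ Ideal.span {formPoly d}

/-- The function field `F(p)` of the quadric `p = 0`: the total fraction ring of the
coordinate ring (the quotient field when the coordinate ring is a domain, i.e. when `p` is
anisotropic of dimension at least 2). -/
abbrev FunField {F : Type*} [Field F] {n : ℕ} (d : Fin n → F) : Type _ :=
  FractionRing (CoordRing d)

end QF

namespace QF

section Basics

variable {R S : Type*} [CommRing R] [CommRing S] {ι κ : Type*} [Fintype ι] [Fintype κ]

/-- The diagonal quadratic form with coefficients `d` on an arbitrary finite index type. -/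
def qv (d v : ι → R) : R := ∑ i, d i * v i ^ 2

/-- The bilinear form whose associated quadratic form is `qv d`. -/
def bv (d v w : ι → R) : R := ∑ i, d i * (v i * w i)

/-- Anisotropy of a diagonal form on an arbitrary finite index type. -/
def Aniso (d : ι → R) : Prop := ∀ v, qv d v = 0 → v = 0

theorem bv_self (d v : ι → R) : bv d v v = qv d v := by
  simp only [bv, qv, sq]

theorem bv_comm (d v w : ι → R) : bv d v w = bv d w v := by
  simp only [bv, mul_comm (v _)]

theorem bv_add_left (d u v w : ι → R) : bv d (u + v) w = bv d u w + bv d v w := by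
  simp only [bv, ← Finset.sum_add_distrib, Pi.add_apply]
  exact Finset.sum_congr rfl fun i _ => by ring

theorem bv_smul_left (d : ι → R) (c : R) (v w : ι → R) : bv d (c • v) w = c * bv d v w := by
  simp only [bv, Finset.mul_sum, Pi.smul_apply, smul_eq_mul]
  exact Finset.sum_congr rfl fun i _ => by ring

theorem bv_add_right (d u v w : ι → R) : bv d u (v + w) = bv d u v + bv d u w := by
  rw [bv_comm, bv_add_left, bv_comm, bv_comm d w]

theorem bv_smul_right (d : ι → R) (c : R) (v w : ι → R) : bv d v (c • w) = c * bv d v w := by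
  rw [bv_comm, bv_smul_left, bv_comm]

theorem qv_add (d v w : ι → R) : qv d (v + w) = qv d v + 2 * bv d v w + qv d w := by
  simp only [← bv_self, bv_add_left, bv_add_right, bv_comm d w v]; ring

theorem qv_smul (d : ι → R) (c : R) (v : ι → R) : qv d (c • v) = c ^ 2 * qv d v := by
  simp only [← bv_self, bv_smul_left, bv_smul_right]; ring

theorem qv_zero (d : ι → R) : qv d 0 = 0 := by simp [qv]

theorem qv_zero_left (v : ι → R) : qv 0 v = 0 := by simp [qv]

theorem map_qv (f : R →+* S) (d v : ι → R) : f (qv d v) = qv (f ∘ d) (f ∘ v) := by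
  simp [qv]

theorem map_bv (f : R →+* S) (d v w : ι → R) : f (bv d v w) = bv (f ∘ d) (f ∘ v) (f ∘ w) := by
  simp [bv]

theorem bv_single_left [DecidableEq ι] (d : ι → R) (i : ι) (w : ι → R) :
    bv d (Pi.single i 1) w = d i * w i := by
  simp [bv, Pi.single_apply]

theorem qv_single [DecidableEq ι] (d : ι → R) (i : ι) : qv d (Pi.single i 1) = d i := by
  rw [← bv_self, bv_single_left, Pi.single_eq_same, mul_one]

theorem qv_sum_elim (d : ι → R) (e : κ → R) (z : ι ⊕ κ → R) :
    qv (Sum.elim d e) z = qv d (z ∘ Sum.inl) + qv e (z ∘ Sum.inr) := by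
  simp [qv]

theorem eq_zero_of_bv (d : ι → R) [NoZeroDivisors R] (hd : ∀ i, d i ≠ 0) (v : ι → R)
    (h : ∀ w, bv d w v = 0) : v = 0 := by
  ext i
  have := h (Pi.single i 1)
  rw [bv_single_left] at this
  exact (mul_eq_zero.mp this).resolve_left (hd i)

theorem bv_mulVec (e : κ → R) {ι' : Type*} [Fintype ι'] (A : Matrix κ ι R) (B : Matrix κ ι' R)
    (v : ι → R) (w : ι' → R) :
    bv e (A.mulVec v) (B.mulVec w)
      = ∑ i, ∑ j, v i * w j * bv e (fun k => A k i) (fun k => B k j) := by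
  simp only [bv, Matrix.mulVec, dotProduct, Finset.mul_sum, Finset.sum_mul]
  rw [Finset.sum_comm]
  conv_lhs => enter [2, y]; rw [Finset.sum_comm]
  rw [Finset.sum_comm]
  refine Finset.sum_congr rfl fun i _ => Finset.sum_congr rfl fun j _ =>
    Finset.sum_congr rfl fun k _ => by ring

theorem bv_diag (d v w : ι → R) :
    bv d v w = ∑ i, ∑ j, v i * w j * (if i = j then d i else 0) := by
  simp only [bv, mul_ite, mul_zero, Finset.sum_ite_eq, Finset.mem_univ, if_true]
  exact Finset.sum_congr rfl fun i _ => by ring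

theorem bv_of_qv_eq {d : ι → R} {e : κ → R} (ψ : (ι → R) →ₗ[R] (κ → R)) (c : R)
    (h : ∀ v, qv e (ψ v) = c * qv d v) (v w : ι → R) :
    2 * bv e (ψ v) (ψ w) = 2 * (c * bv d v w) := by
  have := h (v + w)
  rw [map_add, qv_add, qv_add, h, h] at this
  linear_combination this

/-- Base change of a linear map along a ring homomorphism. -/
noncomputable def bcMap (f : R →+* S) (ψ : (ι → R) →ₗ[R] (κ → R)) : (ι → S) →ₗ[S] (κ → S) :=
  Matrix.mulVecLin ((LinearMap.toMatrix' ψ).map f)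

theorem bcMap_comp {μ : Type*} [Fintype μ] (f : R →+* S) (ψ : (ι → R) →ₗ[R] (κ → R))
    (φ : (κ → R) →ₗ[R] (μ → R)) : bcMap f (φ ∘ₗ ψ) = bcMap f φ ∘ₗ bcMap f ψ := by
  unfold bcMap
  rw [LinearMap.toMatrix'_comp, Matrix.map_mul, Matrix.mulVecLin_mul]

theorem bcMap_id (f : R →+* S) : bcMap f (LinearMap.id : (ι → R) →ₗ[R] (ι → R)) = LinearMap.id := by
  unfold bcMap
  rw [LinearMap.toMatrix'_id, Matrix.map_one f f.map_zero f.map_one, Matrix.mulVecLin_one]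

theorem qv_bcMap [NoZeroDivisors S] (h2 : (2 : S) ≠ 0) (f : R →+* S)
    {d : ι → R} {e : κ → R} (ψ : (ι → R) →ₗ[R] (κ → R)) (h : ∀ v, qv e (ψ v) = qv d v)
    (x : ι → S) : qv (f ∘ e) (bcMap f ψ x) = qv (f ∘ d) x := by
  rw [← bv_self, ← bv_self]
  simp only [bcMap, Matrix.mulVecLin_apply]
  rw [bv_mulVec, bv_diag]
  refine Finset.sum_congr rfl fun i _ => Finset.sum_congr rfl fun j _ => ?_
  congr 1
  have h3 := congrArg f (bv_of_qv_eq ψ 1 (by simpa using h) (Pi.single i 1) (Pi.single j 1))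
  simp only [map_mul, map_ofNat, one_mul] at h3
  have h4 := mul_left_cancel₀ h2 h3
  rw [map_bv] at h4
  rw [bv_single_left] at h4
  simp only [Matrix.map_apply, LinearMap.toMatrix'_apply]
  convert h4 using 1
  · congr 1
  · simp [Pi.single_apply, apply_ite f]

end Basics

section ClearDenominators

variable {R K : Type*} [CommRing R] [IsDomain R] [Field K] [Algebra R K] [IsFractionRing R K]
  {ι : Type*} [Fintype ι]

theorem exists_clear_denominators (v : ι → K) :
    ∃ (h : R) (g : ι → R), h ≠ 0 ∧ ∀ i, algebraMap R K h * v i = algebraMap R K (g i) := by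
  obtain ⟨b, hb⟩ := IsLocalization.exist_integer_multiples_of_finite (nonZeroDivisors R) v
  choose g hg using hb
  exact ⟨b, g, nonZeroDivisors.ne_zero b.2, fun i => by
    rw [hg i, Algebra.smul_def]⟩

theorem qv_clear_denominators {d : ι → R} {v : ι → K} {f : R}
    (hv : qv (algebraMap R K ∘ d) v = algebraMap R K f) :
    ∃ (h : R) (g : ι → R), h ≠ 0 ∧ qv d g = f * h ^ 2 ∧ ∀ i, v i ≠ 0 → g i ≠ 0 := by
  obtain ⟨h, g, hh, hg⟩ := exists_clear_denominators (R := R) v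
  have hh' : algebraMap R K h ≠ 0 := by
    simpa using hh
  refine ⟨h, g, hh, ?_, fun i hi hgi => ?_⟩
  · apply IsFractionRing.injective R K
    have : (algebraMap R K ∘ g) = algebraMap R K h • v := by
      ext i; simp [hg]
    rw [map_qv, this, qv_smul, hv, map_mul, map_pow]; ring
  · have := hg i
    rw [hgi, map_zero] at this
    exact (mul_ne_zero hh' hi) this

theorem Aniso.fractionRing {d : ι → R} (hd : Aniso d) : Aniso (algebraMap R K ∘ d) := by
  intro v hv
  obtain ⟨h, g, hh, hg, hne⟩ :=
    qv_clear_denominators (K := K) (d := d) (v := v) (f := 0) (by simpa using hv)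
  have := hd g (by simpa using hg)
  by_contra hv0
  obtain ⟨i, hi⟩ := Function.ne_iff.mp hv0
  exact hne i hi (by simp [this])

end ClearDenominators

section OneVariable

open Polynomial

variable {k : Type*} [Field k] {ι : Type*} [Fintype ι] {d : ι → k}

theorem eval_qv (a : k) (g : ι → k[X]) :
    (qv (C ∘ d) g).eval a = qv d (fun i => (g i).eval a) := by
  have := map_qv (evalRingHom a) (C ∘ d) g
  simpa [Function.comp_def] using this

theorem Aniso.exists_eq_smul (hd : Aniso d) {a : k} {g : ι → k[X]}
    (h : (qv (C ∘ d) g).eval a = 0) : ∃ g' : ι → k[X], g = (X - C a) • g' := by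
  rw [eval_qv] at h
  have h0 := hd _ h
  have : ∀ i, (X - C a) ∣ g i := fun i => dvd_iff_isRoot.mpr (congrFun h0 i)
  choose g' hg' using this
  exact ⟨g', funext hg'⟩

theorem Aniso.polynomial (hd : Aniso d) : Aniso (C ∘ d : ι → k[X]) := by
  intro g hg
  have key : ∀ m : ℕ, ∃ g' : ι → k[X], g = (X - C (0 : k)) ^ m • g' := by
    intro m
    induction m with
    | zero => exact ⟨g, by simp⟩
    | succ m ih =>
      obtain ⟨g', hg'⟩ := ih
      have h0 : qv (C ∘ d) g' = 0 := by
        rw [hg', qv_smul] at hg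
        exact (mul_eq_zero.mp hg).resolve_left
          (pow_ne_zero _ (pow_ne_zero _ (X_sub_C_ne_zero 0)))
      obtain ⟨g'', hg''⟩ := hd.exists_eq_smul (a := 0) (g := g') (by simp [h0])
      exact ⟨g'', by rw [hg', hg'', smul_smul, pow_succ]⟩
  ext1 i
  by_contra hi
  obtain ⟨g', hg'⟩ := key ((g i).natDegree + 1)
  have hdvd : (X - C (0 : k)) ^ ((g i).natDegree + 1) ∣ g i := ⟨g' i, congrFun hg' i⟩
  have := natDegree_le_of_dvd hdvd hi
  rw [natDegree_pow, natDegree_X_sub_C] at this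
  omega

/-- If an anisotropic form represents a polynomial over the field of rational functions, then it
represents every value of this polynomial over the base field. -/
theorem Aniso.exists_qv_eq_eval (hd : Aniso d) (a : k) {f : k[X]} (n : ℕ) :
    ∀ {g : ι → k[X]} {h : k[X]}, h.natDegree ≤ n → h ≠ 0 → qv (C ∘ d) g = f * h ^ 2 →
    ∃ y, qv d y = f.eval a := by
  induction n with
  | zero =>
    intro g h hn hh hg
    obtain ⟨c, rfl⟩ := natDegree_eq_zero.mp (Nat.le_zero.mp hn)
    have hc : c ≠ 0 := by rintro rfl; simp at hh
    have := congrArg (eval a) hg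
    rw [eval_qv] at this
    refine ⟨c⁻¹ • fun i => (g i).eval a, ?_⟩
    rw [qv_smul, this]
    simp only [eval_mul, eval_pow, eval_C]
    field_simp
  | succ n ih =>
    intro g h hn hh hg
    by_cases h0 : h.eval a = 0
    · obtain ⟨h', rfl⟩ := dvd_iff_isRoot.mpr h0
      obtain ⟨g', rfl⟩ := hd.exists_eq_smul (a := a) (g := g) (by rw [hg]; simp)
      have hh' : h' ≠ 0 := right_ne_zero_of_mul hh
      refine ih (g := g') (h := h') ?_ hh' ?_
      · rw [natDegree_mul (X_sub_C_ne_zero a) hh', natDegree_X_sub_C] at hn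
        omega
      · rw [qv_smul] at hg
        refine mul_left_cancel₀ (pow_ne_zero 2 (X_sub_C_ne_zero a)) ?_
        rw [hg]; ring
    · have := congrArg (eval a) hg
      rw [eval_qv] at this
      refine ⟨(h.eval a)⁻¹ • fun i => (g i).eval a, ?_⟩
      rw [qv_smul, this]
      simp only [eval_mul, eval_pow]
      field_simp

theorem algebraMap_comp_ratFunc {ι : Type*} (d : ι → k) :
    algebraMap k (RatFunc k) ∘ d = algebraMap k[X] (RatFunc k) ∘ C ∘ d := by
  ext i
  simp only [Function.comp_apply]
  rw [IsScalarTower.algebraMap_apply k k[X] (RatFunc k)]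
  rfl

theorem Aniso.ratFunc (hd : Aniso d) : Aniso (algebraMap k (RatFunc k) ∘ d) := by
  rw [algebraMap_comp_ratFunc]
  exact hd.polynomial.fractionRing

theorem Aniso.exists_qv_eq_of_ratFunc (hd : Aniso d) {v : ι → RatFunc k} {c : k}
    (hv : qv (algebraMap k (RatFunc k) ∘ d) v = algebraMap k (RatFunc k) c) :
    ∃ y, qv d y = c := by
  rw [algebraMap_comp_ratFunc, IsScalarTower.algebraMap_apply k k[X] (RatFunc k)] at hv
  obtain ⟨h, g, hh, hg, -⟩ := qv_clear_denominators hv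
  obtain ⟨y, hy⟩ := hd.exists_qv_eq_eval 0 h.natDegree le_rfl hh hg
  exact ⟨y, by simpa using hy⟩

/-- The **Cassels–Pfister theorem** for anisotropic diagonal forms. -/
theorem Aniso.cassels_pfister (hd : Aniso d) {f : k[X]} (n : ℕ) :
    ∀ {g : ι → k[X]} {h : k[X]}, h.natDegree ≤ n → h ≠ 0 → qv (C ∘ d) g = f * h ^ 2 →
    ∃ w, qv (C ∘ d) w = f := by
  induction n with
  | zero =>
    intro g h hn hh hg
    obtain ⟨c, rfl⟩ := natDegree_eq_zero.mp (Nat.le_zero.mp hn)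
    have hc : c ≠ 0 := by rintro rfl; simp at hh
    refine ⟨C c⁻¹ • g, ?_⟩
    rw [qv_smul, hg]
    have : C c⁻¹ * C c = 1 := by rw [← C_mul, inv_mul_cancel₀ hc, C_1]
    linear_combination f * (C c⁻¹ * C c + 1) * this
  | succ n ih =>
    intro g h hn hh hg
    by_cases hn' : h.natDegree ≤ n
    · exact ih hn' hh hg
    have hdeg : h.natDegree = n + 1 := by omega
    set w : ι → k[X] := fun i => g i / h with hw
    set r : ι → k[X] := fun i => g i % h with hr
    have hgr : g = r + h • w := by
      ext1 i
      simp only [hw, hr, Pi.add_apply, Pi.smul_apply, smul_eq_mul]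
      exact (EuclideanDomain.mod_add_div (g i) h).symm
    have hrdeg : ∀ i, (r i).natDegree ≤ n := by
      intro i
      have := natDegree_mod_lt (g i) (q := h) (by omega)
      simp only [hr]
      omega
    by_cases hr0 : r = 0
    · refine ⟨w, mul_left_cancel₀ (pow_ne_zero 2 hh) ?_⟩
      rw [hr0, zero_add] at hgr
      rw [hgr, qv_smul] at hg
      rw [hg]; ring
    have hqr : qv (C ∘ d) r ≠ 0 := fun h0 => hr0 (hd.polynomial r h0)
    set h' := h * (f + qv (C ∘ d) w) - 2 * bv (C ∘ d) g w with hh'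
    have hr' : r = g + (-h) • w := by rw [hgr]; simp
    have hmul : qv (C ∘ d) r = h * h' := by
      rw [hr', qv_add, qv_smul, bv_smul_right, hg, hh']; ring
    have hh'0 : h' ≠ 0 := fun h0 => hqr (by rw [hmul, h0, mul_zero])
    have hdegr : (qv (C ∘ d) r).natDegree ≤ n + n := by
      refine natDegree_sum_le_of_forall_le _ _ fun i _ => ?_
      refine (natDegree_C_mul_le _ _).trans ?_
      refine natDegree_pow_le.trans ?_
      have := hrdeg i
      omega
    refine ih (g := (qv (C ∘ d) w - f) • g + (2 * (f * h - bv (C ∘ d) g w)) • w) (h := h') ?_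
      hh'0 ?_
    · rw [hmul, natDegree_mul hh hh'0] at hdegr
      omega
    · rw [qv_add, qv_smul, qv_smul, bv_smul_left, bv_smul_right, hg, hh']
      ring

theorem Aniso.natDegree_le_one (hd : Aniso d) {w : ι → k[X]} {f : k[X]} (hf : f.natDegree ≤ 2)
    (hw : qv (C ∘ d) w = f) (n : ℕ) (hn : ∀ i, (w i).natDegree ≤ n + 1) :
    ∀ i, (w i).natDegree ≤ 1 := by
  induction n with
  | zero => exact hn
  | succ n ih =>
    refine ih fun i => ?_
    have hc : f.coeff ((n + 1 + 1) * 2) = 0 := coeff_eq_zero_of_natDegree_lt (by omega)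
    have hq : qv d (fun i => (w i).coeff (n + 1 + 1)) = 0 := by
      rw [← hc, ← hw, qv, qv, finsetSum_coeff]
      refine Finset.sum_congr rfl fun j _ => ?_
      rw [Function.comp_apply, coeff_C_mul, mul_comm (n + 1 + 1) 2,
        coeff_pow_of_natDegree_le (hn j)]
    have h0 := congrFun (hd _ hq) i
    have := hn i
    by_contra hcon
    have heq : (w i).natDegree = n + 1 + 1 := by omega
    have hlc : (w i).leadingCoeff = 0 := by rw [leadingCoeff, heq]; exact h0
    rw [leadingCoeff_eq_zero] at hlc
    rw [hlc] at heq
    simp at heq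

/-- The second representation theorem: if `⟨a⟩ ⊥ s` represents `a X ^ 2 + c` over the rational
function field, then `s` represents `c`. -/
theorem Aniso.second_representation (h2 : (2 : k) ≠ 0) {a c : k}
    (hd : Aniso (Sum.elim (fun _ : Unit => a) d))
    {v : Unit ⊕ ι → RatFunc k}
    (hv : qv (algebraMap k (RatFunc k) ∘ Sum.elim (fun _ : Unit => a) d) v
      = algebraMap k (RatFunc k) a * RatFunc.X ^ 2 + algebraMap k (RatFunc k) c) :
    ∃ y, qv d y = c := by
  have hf : qv (algebraMap k[X] (RatFunc k) ∘ (C ∘ Sum.elim (fun _ : Unit => a) d)) v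
      = algebraMap k[X] (RatFunc k) (C a * X ^ 2 + C c) := by
    rw [← algebraMap_comp_ratFunc, hv, map_add, map_mul, map_pow, RatFunc.algebraMap_X,
      RatFunc.algebraMap_C, RatFunc.algebraMap_C]
    rfl
  obtain ⟨h, g, hh, hg, -⟩ := qv_clear_denominators hf
  obtain ⟨w, hw⟩ := hd.cassels_pfister h.natDegree le_rfl hh hg
  have hle := hd.natDegree_le_one (by compute_degree) hw
    (∑ i, (w i).natDegree) (fun i => (Finset.single_le_sum (f := fun i => (w i).natDegree)
      (fun _ _ => Nat.zero_le _) (Finset.mem_univ i)).trans (Nat.le_succ _))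
  obtain ⟨x, hx⟩ : ∃ x : k, (w (Sum.inl ())).eval x ^ 2 = x ^ 2 := by
    obtain ⟨β, α, hαβ⟩ := exists_eq_X_add_C_of_natDegree_le_one (hle (Sum.inl ()))
    rw [hαβ]
    by_cases hβ : β = 1
    · refine ⟨-α / 2, ?_⟩
      subst hβ
      simp
      field_simp
      ring
    · have : 1 - β ≠ 0 := sub_ne_zero.mpr (Ne.symm hβ)
      refine ⟨α / (1 - β), ?_⟩
      simp
      field_simp
      ring
  have he := congrArg (eval x) hw
  rw [eval_qv, qv_sum_elim] at he
  simp only [eval_add, eval_mul, eval_C, eval_pow, eval_X] at he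
  have h1 : qv (fun _ : Unit => a) ((fun i => eval x (w i)) ∘ Sum.inl) = a * x ^ 2 := by
    simp [qv, hx]
  rw [h1] at he
  exact ⟨_, add_left_cancel he⟩

end OneVariable

section MvPolynomial

variable {k : Type*} [Field k] {ι : Type*} [Fintype ι] {d : ι → k}

instance infinite_ratFunc : Infinite (RatFunc k) :=
  Infinite.of_injective _ (IsFractionRing.injective (Polynomial k) (RatFunc k))

theorem Aniso.mvPolynomial (hd : Aniso d) (σ : Type*) :
    Aniso (MvPolynomial.C ∘ d : ι → MvPolynomial σ k) := by
  intro g hg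
  ext1 i
  apply MvPolynomial.map_injective _ (algebraMap k (RatFunc k)).injective
  simp only [Pi.zero_apply, map_zero]
  refine MvPolynomial.funext fun x => ?_
  have h1 := map_qv (MvPolynomial.eval₂Hom (algebraMap k (RatFunc k)) x) (MvPolynomial.C ∘ d) g
  rw [hg, map_zero] at h1
  have h2 : (MvPolynomial.eval₂Hom (algebraMap k (RatFunc k)) x : MvPolynomial σ k → RatFunc k)
      ∘ (MvPolynomial.C ∘ d) = algebraMap k (RatFunc k) ∘ d := by
    ext j; simp
  rw [h2] at h1
  have h3 := congrFun (hd.ratFunc _ h1.symm) i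
  rw [MvPolynomial.eval_map, map_zero]
  exact h3

end MvPolynomial

section Pfister

variable {k : Type*} [Field k] {ι κ : Type*} [Fintype ι] [Fintype κ]

/-- A diagonal form is round if each of its nonzero values is a similarity factor. -/
def Round (d : ι → k) : Prop :=
  ∀ x, qv d x ≠ 0 → ∃ U : (ι → k) →ₗ[k] (ι → k), ∀ v, qv d (U v) = qv d x * qv d v

theorem Round.of_isometry {d : ι → k} {e : κ → k} (he : Round e)
    (φ : (ι → k) →ₗ[k] (κ → k)) (hφ : ∀ v, qv e (φ v) = qv d v)
    (ψ : (κ → k) →ₗ[k] (ι → k)) (hψ : ∀ v, qv d (ψ v) = qv e v) : Round d := by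
  intro x hx
  rw [← hφ] at hx
  obtain ⟨U, hU⟩ := he _ hx
  refine ⟨ψ ∘ₗ U ∘ₗ φ, fun v => ?_⟩
  simp only [LinearMap.comp_apply, hψ, hU, hφ]

theorem bv_similitude (h2 : (2 : k) ≠ 0) {d : ι → k} {t : k} {U : (ι → k) →ₗ[k] (ι → k)}
    (hU : ∀ v, qv d (U v) = t * qv d v) (v w : ι → k) : bv d (U v) (U w) = t * bv d v w :=
  mul_left_cancel₀ h2 (bv_of_qv_eq U t hU v w)

theorem injective_similitude (h2 : (2 : k) ≠ 0) {d : ι → k} (hd : ∀ i, d i ≠ 0) {t : k}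
    (ht : t ≠ 0) {U : (ι → k) →ₗ[k] (ι → k)} (hU : ∀ v, qv d (U v) = t * qv d v) :
    Function.Injective U := by
  rw [injective_iff_map_eq_zero]
  intro v hv
  refine eq_zero_of_bv d hd v fun w => ?_
  have := bv_similitude h2 hU w v
  rw [hv, ← zero_smul k (0 : ι → k), bv_smul_right, zero_mul] at this
  exact (mul_eq_zero.mp this.symm).resolve_left ht

theorem round_double_aux {d : ι → k} (a r s : k) (U V W : (ι → k) →ₗ[k] (ι → k))
    (hU : ∀ v, qv d (U v) = r * qv d v) (hV : ∀ v, qv d (V v) = s * qv d v)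
    (hW : ∀ v, qv d (W v) = r * qv d v) (hb : ∀ v w, bv d (V v) (W w) = bv d (U v) (V w)) :
    ∃ T : ((ι → k) × (ι → k)) →ₗ[k] ((ι → k) × (ι → k)), ∀ z,
      qv d (T z).1 + a * qv d (T z).2 = (r + a * s) * (qv d z.1 + a * qv d z.2) := by
  refine ⟨LinearMap.prod (U ∘ₗ LinearMap.fst k _ _ + (-a) • (V ∘ₗ LinearMap.snd k _ _))
    (V ∘ₗ LinearMap.fst k _ _ + W ∘ₗ LinearMap.snd k _ _), fun z => ?_⟩
  simp only [LinearMap.prod_apply, Function.prod, LinearMap.add_apply, LinearMap.smul_apply,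
    LinearMap.comp_apply, LinearMap.fst_apply, LinearMap.snd_apply]
  rw [qv_add, qv_add, qv_smul, bv_smul_right, hU, hV, hV, hW, hb]
  ring

theorem Round.double (h2 : (2 : k) ≠ 0) {d : ι → k} (hd : ∀ i, d i ≠ 0) (hr : Round d) (a : k)
    (x y : ι → k) (hxy : qv d x + a * qv d y ≠ 0) :
    ∃ T : ((ι → k) × (ι → k)) →ₗ[k] ((ι → k) × (ι → k)), ∀ z,
      qv d (T z).1 + a * qv d (T z).2
        = (qv d x + a * qv d y) * (qv d z.1 + a * qv d z.2) := by
  have zero_bv : ∀ w, bv d 0 w = 0 := fun w => by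
    rw [← zero_smul k (0 : ι → k), bv_smul_left, zero_mul]
  by_cases hs : qv d y = 0
  · have hr0 : qv d x ≠ 0 := by rintro h; simp [h, hs] at hxy
    obtain ⟨U, hU⟩ := hr x hr0
    exact round_double_aux a _ _ U 0 U hU (by simp [hs, qv_zero]) hU
      (fun v w => by simp [bv_comm d (U v) 0, zero_bv])
  · obtain ⟨V, hV⟩ := hr y hs
    by_cases hr0 : qv d x = 0
    · exact round_double_aux a _ _ 0 V 0 (by simp [hr0, qv_zero]) hV (by simp [hr0, qv_zero])
        (fun v w => by simp [bv_comm d (V v) 0, zero_bv])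
    · obtain ⟨U, hU⟩ := hr x hr0
      let e := LinearEquiv.ofInjectiveEndo U (injective_similitude h2 hd hr0 hU)
      have he : ∀ v, U (e.symm v) = v := fun v => e.apply_symm_apply v
      have heq : ∀ v, qv d (e.symm v) = (qv d x)⁻¹ * qv d v := fun v => by
        have := hU (e.symm v)
        rw [he] at this
        rw [this]; field_simp
      refine round_double_aux a _ _ U V
        ((qv d x / qv d y) • (V ∘ₗ (e.symm : (ι → k) →ₗ[k] (ι → k)) ∘ₗ V)) hU hV ?_ ?_
      · intro v
        simp only [LinearMap.smul_apply, LinearMap.comp_apply, qv_smul, LinearEquiv.coe_coe, hV,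
          heq]
        field_simp
      · intro v w
        simp only [LinearMap.smul_apply, LinearMap.comp_apply, bv_smul_right, LinearEquiv.coe_coe,
          bv_similitude h2 hV]
        have := bv_similitude h2 hU v (e.symm (V w))
        rw [he] at this
        rw [this]; field_simp

/-- The Pfister form with its coefficients indexed by `Fin n → Fin 2`. -/
def pfisterFun {n : ℕ} (a : Fin n → k) (i : Fin n → Fin 2) : k :=
  ∏ j : Fin n, if i j = 0 then 1 else a j

theorem pfisterFun_ne_zero {n : ℕ} {a : Fin n → k} (ha : ∀ i, a i ≠ 0) (i : Fin n → Fin 2) :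
    pfisterFun a i ≠ 0 :=
  Finset.prod_ne_zero_iff.mpr fun j _ => by split_ifs <;> simp [ha]

theorem qv_pfisterFun_succ {n : ℕ} (a : Fin (n + 1) → k) (x : (Fin (n + 1) → Fin 2) → k) :
    qv (pfisterFun a) x
      = qv (pfisterFun fun j => a j.succ) (fun i => x (Fin.cons 0 i))
        + a 0 * qv (pfisterFun fun j => a j.succ) (fun i => x (Fin.cons 1 i)) := by
  simp only [qv]
  rw [← (Fin.consEquiv fun _ : Fin (n + 1) => Fin 2).sum_comp, Fintype.sum_prod_type,
    Fin.sum_univ_two, Finset.mul_sum]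
  simp only [Fin.consEquiv, Equiv.coe_fn_mk, pfisterFun, Fin.prod_univ_succ, Fin.cons_zero,
    Fin.cons_succ]
  congr 1
  · simp
  · exact Finset.sum_congr rfl fun i _ => by simp [mul_assoc]

theorem round_pfisterFun (h2 : (2 : k) ≠ 0) :
    ∀ {n : ℕ} {a : Fin n → k}, (∀ i, a i ≠ 0) → Round (pfisterFun a)
  | 0, a, _ => by
    intro x _
    refine ⟨x default • LinearMap.id, fun v => ?_⟩
    simp only [LinearMap.smul_apply, LinearMap.id_apply, qv_smul]
    congr 1
    rw [qv, Fintype.sum_unique]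
    simp only [pfisterFun, Finset.univ_eq_empty, Finset.prod_empty, one_mul]
    exact congrArg (fun i => x i ^ 2) (Subsingleton.elim _ _)
  | n + 1, a, ha => by
    intro x hx
    have ih := round_pfisterFun h2 (a := fun j : Fin n => a j.succ) fun i => ha _
    rw [qv_pfisterFun_succ] at hx
    obtain ⟨T, hT⟩ := ih.double h2 (pfisterFun_ne_zero fun i => ha _) (a 0) _ _ hx
    let P : ((Fin (n + 1) → Fin 2) → k) →ₗ[k] ((Fin n → Fin 2) → k) × ((Fin n → Fin 2) → k) :=
      LinearMap.prod (LinearMap.funLeft k k fun i => Fin.cons 0 i)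
        (LinearMap.funLeft k k fun i => Fin.cons 1 i)
    let J : ((Fin n → Fin 2) → k) × ((Fin n → Fin 2) → k) →ₗ[k] ((Fin (n + 1) → Fin 2) → k) :=
      { toFun := fun z i => if i 0 = 0 then z.1 (Fin.tail i) else z.2 (Fin.tail i)
        map_add' := fun z w => by
          ext i
          simp only [Pi.add_apply, Prod.fst_add, Prod.snd_add]
          split_ifs <;> rfl
        map_smul' := fun c z => by ext i; simp }
    refine ⟨J ∘ₗ T ∘ₗ P, fun v => ?_⟩
    rw [qv_pfisterFun_succ a x, qv_pfisterFun_succ a v]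
    refine Eq.trans ?_ (hT (P v))
    rw [qv_pfisterFun_succ]
    simp [J, Fin.tail_cons]

theorem round_pfisterOf (h2 : (2 : k) ≠ 0) {n : ℕ} {a : Fin n → k} (ha : ∀ i, a i ≠ 0) :
    Round (pfisterOf a) := by
  refine (round_pfisterFun h2 ha).of_isometry (LinearMap.funLeft k k finFunctionFinEquiv)
    (fun v => ?_) (LinearMap.funLeft k k finFunctionFinEquiv.symm) (fun v => ?_)
  · simp only [qv, LinearMap.funLeft_apply]
    rw [← finFunctionFinEquiv.sum_comp]
    simp [pfisterOf, pfisterFun]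
  · simp only [qv, LinearMap.funLeft_apply]
    rw [← finFunctionFinEquiv.sum_comp]
    simp [pfisterOf, pfisterFun]

theorem bc_pfisterOf {K : Type*} [Field K] (f : k →+* K) {n : ℕ} (a : Fin n → k) :
    f ∘ pfisterOf a = pfisterOf (f ∘ a) := by
  ext i
  simp [pfisterOf, map_prod, apply_ite f]

end Pfister

section FunctionField

variable {F : Type*} [Field F] {m : ℕ}

/-- The element `δ` such that the affine quadric attached to `p` has equation `X₀ ^ 2 = δ`. -/
noncomputable def quadDelta (p : Fin (m + 1) → F) : MvPolynomial (Fin m) F :=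
  -∑ i : Fin m, MvPolynomial.C (p i.succ / p 0) * MvPolynomial.X i ^ 2

theorem finSuccEquiv_formPoly (p : Fin (m + 1) → F) (hp0 : p 0 ≠ 0) :
    MvPolynomial.finSuccEquiv F m (formPoly p)
      = Polynomial.C (MvPolynomial.C (p 0))
        * (Polynomial.X ^ 2 - Polynomial.C (quadDelta p)) := by
  have hC : ∀ c : F, MvPolynomial.finSuccEquiv F m (MvPolynomial.C c)
      = Polynomial.C (MvPolynomial.C c) := fun c => by simp [MvPolynomial.finSuccEquiv_apply]
  rw [formPoly, Fin.sum_univ_succ]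
  simp only [map_add, map_sum, map_mul, map_pow, hC, MvPolynomial.finSuccEquiv_X_zero,
    MvPolynomial.finSuccEquiv_X_succ, quadDelta, map_neg, sub_neg_eq_add, mul_add, Finset.mul_sum,
    ← mul_assoc, ← Polynomial.C_mul, ← MvPolynomial.C_mul, mul_div_cancel₀ _ hp0]

variable {K : Type*} [Field K] [Algebra (MvPolynomial (Fin m) F) K]
  [IsFractionRing (MvPolynomial (Fin m) F) K]

theorem exists_ringHom_funField (p : Fin (m + 1) → F) (hp0 : p 0 ≠ 0)
    [hδ : Fact (∀ r : K, r ^ 2 ≠ algebraMap _ K (quadDelta p) + 0 * r)] :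
    ∃ Θ : FunField p →+* QuadraticAlgebra K (algebraMap _ K (quadDelta p)) 0,
      ∀ x : F, Θ (algebraMap F (FunField p) x)
        = algebraMap K _ (algebraMap (MvPolynomial (Fin m) F) K (MvPolynomial.C x)) := by
  let δ := quadDelta p
  let E := QuadraticAlgebra K (algebraMap _ K δ) 0
  let ι : MvPolynomial (Fin m) F →+* E :=
    (algebraMap K E).comp (algebraMap (MvPolynomial (Fin m) F) K)
  let ω : E := ⟨0, 1⟩
  have hre : ∀ x y : E, (x * y).re = x.re * y.re + algebraMap _ K δ * x.im * y.im :=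
    fun _ _ => rfl
  have him : ∀ x y : E, (x * y).im = x.re * y.im + x.im * y.re + 0 * x.im * y.im :=
    fun _ _ => rfl
  have hιre : ∀ a, (ι a).re = algebraMap _ K a := fun _ => rfl
  have hιim : ∀ a, (ι a).im = 0 := fun _ => rfl
  let ev : Polynomial (MvPolynomial (Fin m) F) →+* E := Polynomial.eval₂RingHom ι ω
  let χ : Polynomial (MvPolynomial (Fin m) F) := Polynomial.X ^ 2 - Polynomial.C δ
  have hχ : χ.Monic := Polynomial.monic_X_pow_sub_C δ two_ne_zero
  have hχdeg : χ.natDegree = 2 := Polynomial.natDegree_X_pow_sub_C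
  have hevχ : ev χ = 0 := by
    have : ω ^ 2 = ι δ := by
      rw [sq]
      apply QuadraticAlgebra.ext
      · rw [hre, hιre]; simp [ω]
      · rw [him, hιim]; simp [ω]
    simp [ev, χ, this]
  have hker : ∀ P, ev P = 0 → χ ∣ P := by
    intro P hP
    rw [← Polynomial.modByMonic_eq_zero_iff_dvd hχ]
    have hdeg : (P %ₘ χ).natDegree ≤ 1 := by
      have := Polynomial.natDegree_modByMonic_lt P hχ (by rintro h; simp [h] at hχdeg)
      omega
    have h0 : ev (P %ₘ χ) = 0 := by
      have h := Polynomial.modByMonic_add_div P χ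
      rw [← h, map_add, map_mul, hevχ, zero_mul, add_zero] at hP
      exact hP
    rw [Polynomial.eq_X_add_C_of_natDegree_le_one hdeg] at h0 ⊢
    set a1 := (P %ₘ χ).coeff 1
    set a0 := (P %ₘ χ).coeff 0
    have hinj := IsFractionRing.injective (MvPolynomial (Fin m) F) K
    have e1 : ev (Polynomial.C a1 * Polynomial.X + Polynomial.C a0) = ι a1 * ω + ι a0 := by
      simp [ev]
    rw [e1] at h0
    have h0re : (ι a1 * ω).re + (ι a0).re = 0 := congrArg QuadraticAlgebra.re h0
    have h0im : (ι a1 * ω).im + (ι a0).im = 0 := congrArg QuadraticAlgebra.im h0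
    rw [hre, hιre, hιre, hιim] at h0re
    rw [him, hιre, hιim, hιim] at h0im
    have h00 : a0 = 0 := hinj (by simpa [ω] using h0re)
    have h01 : a1 = 0 := hinj (by simpa [ω] using h0im)
    simp [h00, h01]
  let Ψ : MvPolynomial (Fin (m + 1)) F →+* E :=
    ev.comp (MvPolynomial.finSuccEquiv F m : MvPolynomial (Fin (m + 1)) F →+* _)
  have hΨ : ∀ g, Ψ g = 0 ↔ g ∈ Ideal.span {formPoly p} := by
    intro g
    rw [Ideal.mem_span_singleton]
    constructor
    · intro h
      obtain ⟨Q, hQ⟩ := hker _ h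
      rw [← map_dvd_iff (MvPolynomial.finSuccEquiv F m), finSuccEquiv_formPoly p hp0]
      refine ⟨Polynomial.C (MvPolynomial.C (p 0)⁻¹) * Q, ?_⟩
      have h1 : Polynomial.C (MvPolynomial.C (p 0)) * Polynomial.C (MvPolynomial.C (p 0)⁻¹)
          = (1 : Polynomial (MvPolynomial (Fin m) F)) := by
        rw [← Polynomial.C_mul, ← MvPolynomial.C_mul, mul_inv_cancel₀ hp0, map_one, map_one]
      calc _ = χ * Q := hQ
        _ = (Polynomial.C (MvPolynomial.C (p 0)) * Polynomial.C (MvPolynomial.C (p 0)⁻¹))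
            * (χ * Q) := by rw [h1, one_mul]
        _ = _ := by ring
    · rintro ⟨Q, rfl⟩
      have : Ψ (formPoly p) = 0 := by
        change ev (MvPolynomial.finSuccEquiv F m (formPoly p)) = 0
        rw [finSuccEquiv_formPoly p hp0, map_mul, hevχ, mul_zero]
      rw [map_mul, this, zero_mul]
  let Ψ' : CoordRing p →+* E := Ideal.Quotient.lift _ Ψ fun g hg => (hΨ g).mpr hg
  have hΨ' : Function.Injective Ψ' := by
    rw [injective_iff_map_eq_zero]
    intro x hx
    obtain ⟨g, rfl⟩ := Ideal.Quotient.mk_surjective x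
    exact Ideal.Quotient.eq_zero_iff_mem.mpr ((hΨ g).mp hx)
  have hu : ∀ y : nonZeroDivisors (CoordRing p), IsUnit (Ψ' y) := by
    intro y
    have : Nontrivial (CoordRing p) := Ψ'.domain_nontrivial
    refine isUnit_iff_ne_zero.mpr fun h => ?_
    exact nonZeroDivisors.ne_zero y.2 (hΨ' (h.trans (map_zero _).symm))
  refine ⟨IsLocalization.lift hu, fun x => ?_⟩
  rw [IsScalarTower.algebraMap_apply F (CoordRing p) (FunField p), IsLocalization.lift_eq]
  change ev (MvPolynomial.finSuccEquiv F m (MvPolynomial.C x)) = _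
  simp only [MvPolynomial.finSuccEquiv_apply, MvPolynomial.eval₂Hom_C, RingHom.comp_apply, ev,
    Polynomial.coe_eval₂RingHom, Polynomial.eval₂_C]
  rfl

end FunctionField

section Skew

theorem quadDelta_not_square {F : Type*} [Field F] {m : ℕ} {K : Type*} [Field K]
    [Algebra (MvPolynomial (Fin m) F) K] [IsFractionRing (MvPolynomial (Fin m) F) K]
    {p : Fin (m + 1) → F} (hp0 : p 0 ≠ 0) (hp : Aniso p) (hm : 0 < m) (r : K) :
    r ^ 2 ≠ algebraMap _ K (quadDelta p) + 0 * r := by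
  intro hr
  rw [zero_mul, add_zero] at hr
  have h := (hp.mvPolynomial (Fin m)).fractionRing (K := K)
    (Fin.cons r fun i => algebraMap (MvPolynomial (Fin m) F) K (MvPolynomial.X i)) ?_
  · have h1 := congrFun h (⟨0, hm⟩ : Fin m).succ
    rw [Fin.cons_succ, Pi.zero_apply] at h1
    exact MvPolynomial.X_ne_zero _ (IsFractionRing.injective (MvPolynomial (Fin m) F) K
      (h1.trans (map_zero _).symm))
  · rw [qv, Fin.sum_univ_succ]
    simp only [Function.comp_apply, Fin.cons_zero, Fin.cons_succ]
    rw [hr, ← map_mul, quadDelta]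
    simp only [← map_pow, ← map_mul, ← map_sum, ← map_add]
    rw [← map_zero (algebraMap (MvPolynomial (Fin m) F) K)]
    congr 1
    rw [mul_neg, Finset.mul_sum, neg_add_eq_zero]
    refine Finset.sum_congr rfl fun i _ => ?_
    rw [← mul_assoc, ← MvPolynomial.C_mul, mul_div_cancel₀ _ hp0]

theorem IsHyperbolic.exists_totally_isotropic {S : Type*} [CommRing S] [Nontrivial S] {n : ℕ}
    {d : Fin n → S} (h : IsHyperbolic d) :
    ∃ k, n = k + k ∧ ∃ (ψ : (Fin k → S) →ₗ[S] (Fin n → S)) (N : (Fin n → S) →ₗ[S] (Fin k → S)),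
      N ∘ₗ ψ = LinearMap.id ∧ ∀ x, qv d (ψ x) = 0 := by
  obtain ⟨k, φ, hφ⟩ := h
  refine ⟨k, by simpa using card_eq_of_linearEquiv S φ, ?_⟩
  let D : (Fin k → S) →ₗ[S] (Fin (k + k) → S) :=
    LinearMap.funLeft S S (Fin.append id id)
  have hl : ∀ x i, D x (Fin.castAdd k i) = x i := fun x i =>
    congrArg x (Fin.append_left id id i)
  have hr : ∀ x i, D x (Fin.natAdd k i) = x i := fun x i =>
    congrArg x (Fin.append_right (m := k) (n := k) id id i)
  refine ⟨φ.symm.toLinearMap ∘ₗ D, LinearMap.funLeft S S (Fin.castAdd k) ∘ₗ φ.toLinearMap, ?_,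
    fun x => ?_⟩
  · refine LinearMap.ext fun x => funext fun i => ?_
    simp [LinearMap.funLeft_apply, hl]
  · have h1 := hφ (φ.symm (D x))
    rw [φ.apply_symm_apply] at h1
    refine h1.symm.trans ?_
    rw [evalQF, Fin.sum_univ_add]
    simp only [hypform, Fin.append_left, Fin.append_right, hl, hr]
    simp

theorem exists_skew_similitude {K : Type*} [Field K] (h2 : (2 : K) ≠ 0) {δ : K}
    [hδ : Fact (∀ r : K, r ^ 2 ≠ δ + 0 * r)] {n k : ℕ} (hn : n = k + k) {q : Fin n → K}
    (hq : Aniso q)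
    (ψ : (Fin k → QuadraticAlgebra K δ 0) →ₗ[QuadraticAlgebra K δ 0]
      (Fin n → QuadraticAlgebra K δ 0))
    (hψ : Function.Injective ψ) (h0 : ∀ x, qv (algebraMap K _ ∘ q) (ψ x) = 0) :
    ∃ A : (Fin n → K) →ₗ[K] (Fin n → K),
      ∀ u, qv q (A u) = -δ * qv q u ∧ bv q u (A u) = 0 := by
  have hδ0 : δ ≠ 0 := fun h => hδ.out 0 (by simp [h])
  let re := QuadraticAlgebra.reₗ (R := K) (a := δ) (b := 0)
  let im := QuadraticAlgebra.imₗ (R := K) (a := δ) (b := 0)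
  have hre : ∀ z : Fin n → QuadraticAlgebra K δ 0, re (qv (algebraMap K _ ∘ q) z)
      = qv q (re ∘ z) + δ * qv q (im ∘ z) := by
    intro z
    simp only [qv, map_sum, Finset.mul_sum, ← Finset.sum_add_distrib]
    refine Finset.sum_congr rfl fun i _ => ?_
    simp [re, im, sq, QuadraticAlgebra.reₗ, QuadraticAlgebra.imₗ]
    ring
  have him : ∀ z : Fin n → QuadraticAlgebra K δ 0, im (qv (algebraMap K _ ∘ q) z)
      = 2 * bv q (re ∘ z) (im ∘ z) := by
    intro z
    simp only [qv, bv, map_sum, Finset.mul_sum]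
    refine Finset.sum_congr rfl fun i _ => ?_
    simp [re, im, sq, QuadraticAlgebra.reₗ, QuadraticAlgebra.imₗ]
    ring
  let ρ : (Fin k → QuadraticAlgebra K δ 0) →ₗ[K] (Fin n → K) :=
    re.compLeft (Fin n) ∘ₗ ψ.restrictScalars K
  have e1 : ∀ x, qv q (ρ x) + δ * qv q (im ∘ ψ x) = 0 := fun x => by
    have := hre (ψ x)
    rw [h0, map_zero] at this
    exact this.symm
  have e2 : ∀ x, bv q (ρ x) (im ∘ ψ x) = 0 := fun x => by
    have := him (ψ x)
    rw [h0, map_zero] at this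
    exact (mul_eq_zero.mp this.symm).resolve_left h2
  have hρ : Function.Injective ρ := by
    rw [injective_iff_map_eq_zero]
    intro x hx
    have h1 := e1 x
    rw [hx, qv_zero, zero_add] at h1
    have h3 := hq _ ((mul_eq_zero.mp h1).resolve_left hδ0)
    refine (injective_iff_map_eq_zero ψ).mp hψ x (funext fun i => ?_)
    exact QuadraticAlgebra.ext (congrFun hx i) (congrFun h3 i)
  have hfin : Module.finrank K (Fin k → QuadraticAlgebra K δ 0)
      = Module.finrank K (Fin n → K) := by
    rw [Module.finrank_pi_fintype, Module.finrank_fin_fun, hn]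
    simp [QuadraticAlgebra.finrank_eq_two, mul_two]
  let σ := LinearEquiv.ofInjectiveOfFinrankEq ρ hρ hfin
  have hσ : ∀ u, ρ (σ.symm u) = u := fun u => σ.apply_symm_apply u
  refine ⟨δ • (im.compLeft (Fin n) ∘ₗ ψ.restrictScalars K ∘ₗ σ.symm.toLinearMap), fun u => ?_⟩
  have h1 := e1 (σ.symm u)
  have h3 := e2 (σ.symm u)
  rw [hσ] at h1 h3
  have h4 : (δ • (im.compLeft (Fin n) ∘ₗ ψ.restrictScalars K ∘ₗ σ.symm.toLinearMap)) u
      = δ • (im ∘ ψ (σ.symm u)) := rfl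
  rw [h4, qv_smul, bv_smul_right, h3]
  exact ⟨by linear_combination δ * h1, mul_zero _⟩

theorem exists_integral_skew_similitude {R K : Type*} [CommRing R] [IsDomain R] [Field K]
    [Algebra R K] [IsFractionRing R K] {n : ℕ} {q : Fin n → R} {δ : R}
    {A : (Fin n → K) →ₗ[K] (Fin n → K)}
    (hA : ∀ u, qv (algebraMap R K ∘ q) (A u) = -algebraMap R K δ * qv (algebraMap R K ∘ q) u ∧
      bv (algebraMap R K ∘ q) u (A u) = 0) :
    ∃ (h : R) (B : (Fin n → R) →ₗ[R] (Fin n → R)), h ≠ 0 ∧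
      ∀ u, qv q (B u) = -(h ^ 2 * δ) * qv q u ∧ bv q u (B u) = 0 := by
  obtain ⟨h, M, hh, hM⟩ := exists_clear_denominators (R := R)
    (fun ij : Fin n × Fin n => LinearMap.toMatrix' A ij.1 ij.2)
  refine ⟨h, Matrix.mulVecLin (Matrix.of fun i j => M (i, j)), hh, fun u => ?_⟩
  have key : algebraMap R K ∘ Matrix.mulVecLin (Matrix.of fun i j => M (i, j)) u
      = algebraMap R K h • A (algebraMap R K ∘ u) := by
    have h1 : A (algebraMap R K ∘ u) = (LinearMap.toMatrix' A).mulVec (algebraMap R K ∘ u) := by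
      rw [LinearMap.toMatrix'_mulVec]
    rw [h1]
    ext i
    simp only [Function.comp_apply, Matrix.mulVecLin_apply, Matrix.mulVec, dotProduct, map_sum,
      Matrix.of_apply, map_mul, Pi.smul_apply, smul_eq_mul, Finset.mul_sum, ← hM]
    exact Finset.sum_congr rfl fun j _ => by ring
  have hinj := IsFractionRing.injective R K
  constructor <;> apply hinj
  · rw [map_qv, key, qv_smul, (hA _).1, map_mul, map_qv]
    simp only [map_neg, map_mul, map_pow]
    ring
  · rw [map_bv, key, bv_smul_right, (hA _).2, mul_zero, map_zero]

theorem bcMap_add {R S ι κ : Type*} [CommRing R] [CommRing S] [Fintype ι]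
    (f : R →+* S) (ψ φ : (ι → R) →ₗ[R] (κ → R)) :
    bcMap f (ψ + φ) = bcMap f ψ + bcMap f φ := by
  unfold bcMap
  rw [map_add, Matrix.map_add _ (map_add f), Matrix.mulVecLin_add]

theorem qv_bcMap_skew {R S : Type*} [CommRing R] [CommRing S] [IsDomain S] (h2 : (2 : S) ≠ 0)
    (g : R →+* S) {n : ℕ} {q : Fin n → R} {c : R} {B : (Fin n → R) →ₗ[R] (Fin n → R)}
    (hB : ∀ u, qv q (B u) = c * qv q u ∧ bv q u (B u) = 0) (y : S) (u : Fin n → S) :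
    qv (g ∘ q) (y • u + bcMap g B u) = (y ^ 2 + g c) * qv (g ∘ q) u := by
  have hs : ∀ (a : R) (v : Fin n → R), qv (fun i => a * q i) v = a * qv q v := fun a v => by
    simp [qv, Finset.mul_sum, mul_assoc]
  have hs' : ∀ (a : R) (v : Fin n → S), qv (g ∘ fun i => a * q i) v = g a * qv (g ∘ q) v :=
    fun a v => by simp [qv, Finset.mul_sum, mul_assoc]
  have h3 := qv_bcMap h2 g (d := fun i => c * q i) (e := q) B (fun v => by rw [hs, (hB v).1]) u
  have h4 := qv_bcMap h2 g (d := fun i => (1 + c) * q i) (e := q) (LinearMap.id + B) (fun v => by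
    rw [hs, LinearMap.add_apply, LinearMap.id_apply, qv_add, (hB v).1, (hB v).2]; ring) u
  rw [hs'] at h3 h4
  rw [bcMap_add, bcMap_id, LinearMap.add_apply, LinearMap.id_apply, qv_add, h3, map_add,
    map_one] at h4
  rw [qv_add, qv_smul, bv_smul_left, h3]
  linear_combination y * h4

end Skew

section Specialization

theorem exists_skew_of_hyperbolic {F : Type*} [Field F] (h2 : (2 : F) ≠ 0) {m n : ℕ}
    (hm : 0 < m) {p : Fin (m + 1) → F} (hp0 : p 0 ≠ 0) (hp : Aniso p) {q : Fin n → F}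
    (hq : Aniso q) (hyp : IsHyperbolic (bc (algebraMap F (FunField p)) q)) :
    ∃ (h : MvPolynomial (Fin m) F)
      (B : (Fin n → MvPolynomial (Fin m) F) →ₗ[MvPolynomial (Fin m) F]
        (Fin n → MvPolynomial (Fin m) F)), h ≠ 0 ∧
      ∀ u, qv (MvPolynomial.C ∘ q) (B u) = -(h ^ 2 * quadDelta p) * qv (MvPolynomial.C ∘ q) u ∧
        bv (MvPolynomial.C ∘ q) u (B u) = 0 := by
  let R := MvPolynomial (Fin m) F
  let K := FractionRing R
  let δ : K := algebraMap R K (quadDelta p)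
  have hfact : Fact (∀ r : K, r ^ 2 ≠ δ + 0 * r) := ⟨quadDelta_not_square hp0 hp hm⟩
  have h2K : (2 : K) ≠ 0 := by
    have := (map_ne_zero ((algebraMap R K).comp MvPolynomial.C)).mpr h2
    rwa [map_ofNat] at this
  have h2E : (2 : QuadraticAlgebra K δ 0) ≠ 0 := by
    have := (map_ne_zero (algebraMap K (QuadraticAlgebra K δ 0))).mpr h2K
    rwa [map_ofNat] at this
  obtain ⟨Θ, hΘ⟩ := exists_ringHom_funField (K := K) p hp0
  have : Nontrivial (FunField p) := Θ.domain_nontrivial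
  obtain ⟨k, hk, ψ, N, hN, hψ⟩ := hyp.exists_totally_isotropic
  have hqK : Aniso (algebraMap R K ∘ (MvPolynomial.C ∘ q)) :=
    (hq.mvPolynomial (Fin m)).fractionRing
  have hΘq : Θ ∘ bc (algebraMap F (FunField p)) q
      = algebraMap K (QuadraticAlgebra K δ 0) ∘ (algebraMap R K ∘ (MvPolynomial.C ∘ q)) :=
    funext fun i => hΘ (q i)
  obtain ⟨A, hA⟩ := exists_skew_similitude h2K hk hqK (bcMap Θ ψ) (fun x y hxy => by
      have h1 := congrArg (bcMap Θ N) hxy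
      rwa [← LinearMap.comp_apply, ← LinearMap.comp_apply, ← bcMap_comp, hN, bcMap_id] at h1)
    (fun x => by
      have h1 := qv_bcMap h2E Θ (d := 0) (e := bc (algebraMap F (FunField p)) q) ψ
        (fun v => by rw [hψ, qv_zero_left]) x
      rw [hΘq] at h1
      rw [h1, qv]
      simp)
  exact exists_integral_skew_similitude hA

theorem exists_qv_eq_of_hyperbolic {F : Type*} [Field F] (h2 : (2 : F) ≠ 0) {m n : ℕ}
    (hm : 0 < m) {p : Fin (m + 1) → F} (hp0 : p 0 ≠ 0) (hp : Aniso p) {q : Fin n → F}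
    (hq : Aniso q) (hyp : IsHyperbolic (bc (algebraMap F (FunField p)) q))
    {L : Type*} [Field L] (f : F →+* L) (hfq : Aniso (f ∘ q)) (v : Fin (m + 1) → L)
    (u : Fin n → L) :
    ∃ y, qv (f ∘ q) y = f (p 0) * qv (f ∘ p) v * qv (f ∘ q) u := by
  obtain ⟨h, B, hh, hB⟩ := exists_skew_of_hyperbolic h2 hm hp0 hp hq hyp
  let j : L →+* RatFunc L := algebraMap L (RatFunc L)
  obtain ⟨c, hc⟩ : ∃ c : Fin m → RatFunc L, MvPolynomial.eval₂Hom (j.comp f) c h ≠ 0 := by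
    by_contra! hcon
    refine hh (MvPolynomial.map_injective (j.comp f) (j.comp f).injective ?_)
    rw [map_zero]
    refine MvPolynomial.funext fun c => ?_
    rw [MvPolynomial.eval_map, map_zero]
    exact hcon c
  let g : MvPolynomial (Fin m) F →+* Polynomial (RatFunc L) :=
    MvPolynomial.eval₂Hom (Polynomial.C.comp (j.comp f)) fun i =>
      Polynomial.C (j (v i.succ)) + Polynomial.X * Polynomial.C (c i - j (v i.succ))
  have hg1 : (Polynomial.evalRingHom 1).comp g = MvPolynomial.eval₂Hom (j.comp f) c := by
    ext <;> simp [g]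
  have hg0 : (Polynomial.evalRingHom 0).comp g
      = MvPolynomial.eval₂Hom (j.comp f) fun i => j (v i.succ) := by
    ext <;> simp [g]
  have hgh : g h ≠ 0 := by
    intro h0
    rw [← hg1, RingHom.comp_apply, h0, map_zero] at hc
    exact hc rfl
  have h2P : (2 : Polynomial (RatFunc L)) ≠ 0 := by
    have := (map_ne_zero (Polynomial.C.comp (j.comp f))).mpr h2
    rwa [map_ofNat] at this
  have hgq : g ∘ (MvPolynomial.C ∘ q) = Polynomial.C ∘ (j ∘ (f ∘ q)) := by
    ext1 i
    simp [g]
  have h3 := qv_bcMap_skew h2P g hB (Polynomial.C (j (v 0)) * g h) (Polynomial.C ∘ (j ∘ u))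
  rw [hgq, ← map_qv Polynomial.C] at h3
  obtain ⟨y, hy⟩ := hfq.ratFunc.exists_qv_eq_eval 0 _ (le_refl _) hgh
    (f := (Polynomial.C (j (v 0)) ^ 2 - g (quadDelta p))
      * Polynomial.C (qv (j ∘ (f ∘ q)) (j ∘ u)))
    (h3.trans (by rw [map_neg, map_mul, map_pow]; ring))
  have hδ : Polynomial.eval 0 (g (quadDelta p))
      = j (-∑ i : Fin m, f (p i.succ / p 0) * v i.succ ^ 2) := by
    have := RingHom.congr_fun hg0 (quadDelta p)
    rw [RingHom.comp_apply, Polynomial.coe_evalRingHom] at this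
    rw [this, quadDelta]
    simp
  rw [Polynomial.eval_mul, Polynomial.eval_sub, hδ, Polynomial.eval_pow, Polynomial.eval_C,
    Polynomial.eval_C, ← map_qv j, ← map_pow, ← map_sub, ← map_mul] at hy
  obtain ⟨z, hz⟩ := hfq.exists_qv_eq_of_ratFunc hy
  refine ⟨f (p 0) • z, ?_⟩
  rw [qv_smul, hz]
  have hf0 : f (p 0) ≠ 0 := (map_ne_zero f).mpr hp0
  have h4 : qv (f ∘ p) v
      = f (p 0) * (v 0 ^ 2 - -∑ i : Fin m, f (p i.succ / p 0) * v i.succ ^ 2) := by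
    rw [qv, Fin.sum_univ_succ, sub_neg_eq_add, mul_add, Finset.mul_sum]
    congr 1
    refine Finset.sum_congr rfl fun i _ => ?_
    rw [map_div₀, Function.comp_apply]
    field_simp
  rw [h4]
  ring

end Specialization

section Isom

variable {k : Type*} [Field k] {ι κ μ ν : Type*} [Fintype ι] [Fintype κ] [Fintype μ] [Fintype ν]

/-- Isometry of diagonal forms on arbitrary finite index types. -/
def Isom (d : ι → k) (e : κ → k) : Prop :=
  ∃ φ : (ι → k) ≃ₗ[k] (κ → k), ∀ v, qv e (φ v) = qv d v

theorem Isom.symm {d : ι → k} {e : κ → k} (h : Isom d e) : Isom e d := by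
  obtain ⟨φ, hφ⟩ := h
  exact ⟨φ.symm, fun v => by rw [← hφ, φ.apply_symm_apply]⟩

theorem Isom.trans {d : ι → k} {e : κ → k} {f : μ → k} (h : Isom d e) (h' : Isom e f) :
    Isom d f := by
  obtain ⟨φ, hφ⟩ := h
  obtain ⟨ψ, hψ⟩ := h'
  exact ⟨φ.trans ψ, fun v => by rw [LinearEquiv.trans_apply, hψ, hφ]⟩

theorem Isom.of_equiv {d : ι → k} {e : κ → k} (σ : ι ≃ κ) (h : ∀ i, e (σ i) = d i) :
    Isom d e := by
  refine ⟨LinearEquiv.funCongrLeft k k σ.symm, fun v => ?_⟩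
  rw [qv, ← σ.sum_comp]
  simp [qv, LinearEquiv.funCongrLeft_apply, LinearMap.funLeft_apply, h]

theorem Isom.sum_elim_left (d : ι → k) {e : κ → k} {e' : μ → k} (h : Isom e e') :
    Isom (Sum.elim d e) (Sum.elim d e') := by
  obtain ⟨φ, hφ⟩ := h
  refine ⟨(LinearEquiv.sumArrowLequivProdArrow ι κ k k).trans
    (((LinearEquiv.refl k (ι → k)).prodCongr φ).trans
      (LinearEquiv.sumArrowLequivProdArrow ι μ k k).symm), fun v => ?_⟩
  rw [qv_sum_elim, qv_sum_elim, ← hφ]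
  rfl

theorem Isom.aniso {d : ι → k} {e : κ → k} (h : Isom d e) (he : Aniso e) : Aniso d := by
  obtain ⟨φ, hφ⟩ := h
  intro v hv
  rw [← hφ] at hv
  exact φ.map_eq_zero_iff.mp (he _ hv)

theorem Isom.exists_qv_eq {d : ι → k} {e : κ → k} (h : Isom d e) (v : ι → k) :
    ∃ w, qv e w = qv d v := by
  obtain ⟨φ, hφ⟩ := h
  exact ⟨φ v, hφ v⟩

theorem Isom.map {L : Type*} [Field L] (h2 : (2 : k) ≠ 0) (f : k →+* L) {d : ι → k} {e : κ → k}
    (h : Isom d e) : Isom (f ∘ d) (f ∘ e) := by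
  have h2L : (2 : L) ≠ 0 := by
    have := (map_ne_zero f).mpr h2
    rwa [map_ofNat] at this
  obtain ⟨φ, hφ⟩ := h
  refine ⟨LinearEquiv.ofLinearMap (bcMap f φ.toLinearMap) (bcMap f φ.symm.toLinearMap) ?_ ?_,
    fun v => qv_bcMap h2L f φ.toLinearMap hφ v⟩
  · rw [← bcMap_comp, φ.comp_symm, bcMap_id]
  · rw [← bcMap_comp, φ.symm_comp, bcMap_id]

theorem Isom.ne_zero (h2 : (2 : k) ≠ 0) {d : ι → k} {e : κ → k} (h : Isom d e)
    (he : ∀ i, e i ≠ 0) (i : ι) : d i ≠ 0 := by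
  obtain ⟨φ, hφ⟩ := h
  intro hi
  have h0 : φ (Pi.single i 1) = 0 := by
    refine eq_zero_of_bv e he _ fun w => ?_
    have h1 := mul_left_cancel₀ h2
      (bv_of_qv_eq φ.toLinearMap 1 (by simpa using hφ) (Pi.single i 1) (φ.symm w))
    rw [bv_comm, bv_single_left, hi, zero_mul, mul_zero] at h1
    simpa [bv_comm] using h1
  have h1 := congrFun (φ.map_eq_zero_iff.mp h0) i
  simp at h1

theorem Aniso.right {d : ι → k} {e : κ → k} (h : Aniso (Sum.elim d e)) : Aniso e := by
  intro v hv
  have := h (Sum.elim 0 v) (by rw [qv_sum_elim]; simp [qv_zero, hv])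
  exact funext fun i => congrFun this (Sum.inr i)

theorem Aniso.ne_zero {d : ι → k} (h : Aniso d) (i : ι) : d i ≠ 0 := by
  intro hi
  have := congrFun (h (Pi.single i 1) (by rw [qv_single, hi])) i
  simp at this

theorem exists_isom_sum_elim (h2 : (2 : k) ≠ 0) {e : κ → k} {y : κ → k} (hy : qv e y ≠ 0) :
    ∃ (n : ℕ) (s : Fin n → k), Isom (Sum.elim (fun _ : Unit => qv e y) s) e := by
  have : Invertible (2 : k) := invertibleOfNonzero h2
  let ℓ : (κ → k) →ₗ[k] k :=
    { toFun := bv e y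
      map_add' := bv_add_right e y
      map_smul' := fun c v => bv_smul_right e c y v }
  let W := LinearMap.ker ℓ
  obtain ⟨s, ⟨θ⟩⟩ := QuadraticForm.equivalent_weightedSumSquares
    ((QuadraticMap.weightedSumSquares k e).comp W.subtype)
  have hθ : ∀ x, qv e (θ.symm x : W) = qv s x := by
    intro x
    have h1 := θ.map_app (θ.symm x)
    rw [QuadraticMap.comp_apply, QuadraticMap.weightedSumSquares_apply,
      QuadraticMap.weightedSumSquares_apply] at h1
    have h3 : θ (θ.symm x) = x := θ.toLinearEquiv.apply_symm_apply x
    rw [h3] at h1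
    simp only [smul_eq_mul, ← sq] at h1
    exact h1.symm
  refine ⟨_, s, ?_⟩
  let φ : (Unit ⊕ Fin (Module.finrank k W) → k) →ₗ[k] (κ → k) :=
    (LinearMap.proj (Sum.inl ())).smulRight y
      + W.subtype ∘ₗ θ.symm.toLinearEquiv.toLinearMap ∘ₗ LinearMap.funLeft k k Sum.inr
  have hφ : ∀ z, φ z = z (Sum.inl ()) • y + (θ.symm (z ∘ Sum.inr) : W) := fun _ => rfl
  have hW : ∀ w : W, bv e y w = 0 := fun w => w.2
  refine ⟨LinearEquiv.ofBijective φ ⟨?_, ?_⟩, fun z => ?_⟩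
  · rw [injective_iff_map_eq_zero]
    intro z hz
    rw [hφ] at hz
    have h1 := congrArg (bv e y) hz
    rw [bv_add_right, bv_smul_right, bv_self, hW, add_zero, ← zero_smul k (0 : κ → k),
      bv_smul_right, zero_mul] at h1
    have h3 := (mul_eq_zero.mp h1).resolve_right hy
    rw [h3, zero_smul, zero_add] at hz
    have h4 : z ∘ Sum.inr = 0 :=
      θ.symm.toLinearEquiv.map_eq_zero_iff.mp (Subtype.ext hz)
    ext (i | i)
    · exact h3
    · exact congrFun h4 i
  · intro v
    have hv : v - (bv e y v / qv e y) • y ∈ W := by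
      change bv e y _ = 0
      rw [sub_eq_add_neg, ← neg_smul, bv_add_right, bv_smul_right, bv_self]
      field_simp
      ring
    refine ⟨Sum.elim (fun _ => bv e y v / qv e y) (θ ⟨_, hv⟩), ?_⟩
    rw [hφ, Sum.elim_inl, Sum.elim_comp_inr]
    have h3 : θ.symm (θ ⟨_, hv⟩) = ⟨_, hv⟩ := θ.toLinearEquiv.symm_apply_apply _
    rw [h3]
    simp
  · change qv e (φ z) = _
    rw [hφ, qv_add, qv_smul, bv_smul_left, hW, hθ, qv_sum_elim]
    simp [qv, mul_comm]

end Isom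

universe u

section Subform

variable {F : Type u} [Field F]

/-- A field extension is admissible if it preserves the anisotropy of all diagonal forms. -/
def Admissible {L : Type u} [Field L] (f : F →+* L) : Prop :=
  ∀ (n : ℕ) (d : Fin n → F), Aniso d → Aniso (f ∘ d)

theorem Admissible.ratFunc {L : Type u} [Field L] {f : F →+* L} (hf : Admissible f) :
    Admissible ((algebraMap L (RatFunc L)).comp f) :=
  fun n d hd => (hf n d hd).ratFunc

theorem isom_of_forall_exists_qv_eq (h2 : (2 : F) ≠ 0) :
    ∀ {m : ℕ} {d : Fin m → F} {n : ℕ} {q : Fin n → F}, (∀ i, d i ≠ 0) → Aniso q →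
      (∀ (L : Type u) [Field L] (f : F →+* L), Admissible f →
        ∀ x, ∃ y, qv (f ∘ q) y = qv (f ∘ d) x) →
      ∃ (n' : ℕ) (s : Fin n' → F), Isom (Sum.elim d s) q
  | 0, d, n, q, _, _, _ => ⟨n, q, Isom.of_equiv (Equiv.emptySum (Fin 0) (Fin n)) (by
      rintro (i | i)
      · exact i.elim0
      · rfl)⟩
  | m + 1, d, n, q, hd, hq, h => by
    have hsplit : ∀ (L : Type u) [Field L] (f : F →+* L) (x : Fin (m + 1) → L),
        qv (f ∘ d) x = f (d 0) * x 0 ^ 2 + qv (f ∘ d ∘ Fin.succ) (x ∘ Fin.succ) := by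
      intro L _ f x
      rw [qv, Fin.sum_univ_succ]
      rfl
    obtain ⟨y, hy⟩ := h F (RingHom.id F) (fun n d hd => hd) (Pi.single 0 1)
    have hy' : qv q y = d 0 := hy.trans (qv_single _ _)
    obtain ⟨n₁, s, hs⟩ := exists_isom_sum_elim h2 (e := q) (y := y) (by rw [hy']; exact hd 0)
    rw [hy'] at hs
    have hsan : Aniso s := (hs.aniso hq).right
    obtain ⟨n₂, t, ht⟩ := isom_of_forall_exists_qv_eq h2 (d := d ∘ Fin.succ) (q := s)
      (fun i => hd _) hsan (by
        intro L _ f hf x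
        have h2L : (2 : L) ≠ 0 := by
          have := (map_ne_zero f).mpr h2
          rwa [map_ofNat] at this
        let j := algebraMap L (RatFunc L)
        have hL : Aniso (Sum.elim (fun _ : Unit => f (d 0)) (f ∘ s)) := by
          have := (hs.map h2 f).aniso (hf n q hq)
          rwa [Sum.comp_elim] at this
        obtain ⟨y, hy⟩ := h (RatFunc L) (j.comp f) hf.ratFunc (Fin.cons RatFunc.X (j ∘ x))
        obtain ⟨z, hz⟩ := (hs.map h2 (j.comp f)).symm.exists_qv_eq y
        rw [hy, hsplit, Fin.cons_zero] at hz
        have h4 : (Fin.cons RatFunc.X (j ∘ x) : Fin (m + 1) → RatFunc L) ∘ Fin.succ = j ∘ x := by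
          ext1 i; simp
        rw [h4] at hz
        refine hL.second_representation h2L (v := z) ?_
        refine Eq.trans ?_ (hz.trans ?_)
        · congr 1
          ext1 (i | i) <;> rfl
        · rw [map_qv]; rfl)
    refine ⟨n₂, t, Isom.trans ?_ ((ht.sum_elim_left _).trans hs)⟩
    let σ : Fin (m + 1) ≃ Unit ⊕ Fin m :=
      (finSuccEquiv m).trans ((Equiv.optionEquivSumPUnit (Fin m)).trans (Equiv.sumComm _ _))
    refine Isom.of_equiv ((σ.sumCongr (Equiv.refl _)).trans (Equiv.sumAssoc _ _ _)) ?_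
    rintro (i | i)
    · refine Fin.cases ?_ (fun i => ?_) i
      · simp [σ]
      · simp [σ]
    · simp

end Subform

section Neighbour

theorem exists_qv_eq_mul_of_neighbour {L : Type*} [Field L] {np n mπ : ℕ} {p : Fin np → L}
    {π : Fin mπ → L} {q : Fin n → L} (hp : Aniso p) (hπ : Round π) {c e : L} (hc : c ≠ 0)
    (he : e ≠ 0) (P : (Fin np → L) →ₗ[L] (Fin mπ → L)) (hP : ∀ v, qv π (P v) = c * qv p v)
    (hdim : mπ < 2 * np) (h : ∀ v u, ∃ y, qv q y = e * qv p v * qv q u) (x : Fin mπ → L)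
    (u : Fin n → L) : ∃ y, qv q y = qv π x * qv q u := by
  by_cases ht : qv π x = 0
  · exact ⟨0, by rw [ht, qv_zero, zero_mul]⟩
  obtain ⟨U, hU⟩ := hπ x ht
  let T : ((Fin np → L) × (Fin np → L)) →ₗ[L] (Fin mπ → L) :=
    (U ∘ₗ P).coprod (-P)
  have hT : LinearMap.ker T ≠ ⊥ := LinearMap.ker_ne_bot_of_finrank_lt (by
    rw [Module.finrank_prod, Module.finrank_fin_fun, Module.finrank_fin_fun]
    omega)
  obtain ⟨⟨v, w⟩, hvw, hne⟩ := (Submodule.ne_bot_iff _).mp hT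
  have h1 : U (P v) = P w := by
    have : U (P v) + -P w = 0 := hvw
    rwa [add_neg_eq_zero] at this
  have h3 : qv p w = qv π x * qv p v := by
    have := congrArg (qv π) h1
    rw [hU, hP, hP] at this
    exact mul_left_cancel₀ hc (by linear_combination -this)
  have hv : qv p v ≠ 0 := by
    intro h0
    rw [h0, mul_zero] at h3
    exact hne (Prod.ext (hp v h0) (hp w h3))
  obtain ⟨y, hy⟩ := h v u
  obtain ⟨z, hz⟩ := h w y
  refine ⟨(e * qv p v)⁻¹ • z, ?_⟩
  rw [qv_smul, hz, hy, h3]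
  field_simp

theorem IsPfister.round {F L : Type*} [Field F] [Field L] (h2 : (2 : F) ≠ 0) {m : ℕ}
    {π : Fin m → F} (h : IsPfister π) (f : F →+* L) : Round (f ∘ π) := by
  have h2L : (2 : L) ≠ 0 := by
    have := (map_ne_zero f).mpr h2
    rwa [map_ofNat] at this
  obtain ⟨n, a, ha, hiso⟩ := h
  have hiso' : Isom π (pfisterOf a) := hiso
  have h3 := hiso'.map h2 f
  rw [bc_pfisterOf] at h3
  obtain ⟨φ, hφ⟩ := h3
  exact (round_pfisterOf h2L fun i => (map_ne_zero f).mpr (ha i)).of_isometry φ.toLinearMap hφ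
    φ.symm.toLinearMap fun v => by
      rw [← hφ]
      exact congrArg _ (φ.apply_symm_apply v)

theorem IsPfister.ne_zero {F : Type*} [Field F] (h2 : (2 : F) ≠ 0) {m : ℕ} {π : Fin m → F}
    (h : IsPfister π) (i : Fin m) : π i ≠ 0 := by
  obtain ⟨n, a, ha, hiso⟩ := h
  have hiso' : Isom π (pfisterOf a) := hiso
  exact hiso'.ne_zero h2
    (fun j => Finset.prod_ne_zero_iff.mpr fun l _ => by split_ifs <;> simp [ha]) i

theorem IsPfister.pos {F : Type*} [Field F] {m : ℕ} {π : Fin m → F} (h : IsPfister π) :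
    0 < m := by
  obtain ⟨n, a, ha, φ, hφ⟩ := h
  have : m = 2 ^ n := by simpa using card_eq_of_linearEquiv F φ
  rw [this]
  positivity

end Neighbour

section Assembly

theorem qv_tensorQF {L : Type*} [CommRing L] {m k : ℕ} (π : Fin m → L) (r : Fin k → L)
    (x : Fin (m * k) → L) :
    qv (tensorQF π r) x = ∑ j, r j * qv π fun i => x (finProdFinEquiv (i, j)) := by
  rw [qv, ← finProdFinEquiv.sum_comp, Fintype.sum_prod_type_right]
  refine Finset.sum_congr rfl fun j _ => ?_
  rw [qv, Finset.mul_sum]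
  refine Finset.sum_congr rfl fun i _ => ?_
  simp only [tensorQF, Equiv.symm_apply_apply]
  ring

theorem comp_tensorQF {F L : Type*} [CommRing F] [CommRing L] (f : F →+* L) {m k : ℕ}
    (π : Fin m → F) (r : Fin k → F) : f ∘ tensorQF π r = tensorQF (f ∘ π) (f ∘ r) := by
  ext i
  simp [tensorQF]

variable {F : Type u} [Field F]

theorem exists_isom_tensorQF (h2 : (2 : F) ≠ 0) {m n : ℕ} (hm : 0 < m) {π : Fin m → F}
    (hπ : ∀ i, π i ≠ 0) {q : Fin n → F} (hq : Aniso q)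
    (hround : ∀ (L : Type u) [Field L] (f : F →+* L), Round (f ∘ π))
    (hmul : ∀ (L : Type u) [Field L] (f : F →+* L), Admissible f →
      ∀ x u, ∃ y, qv (f ∘ q) y = qv (f ∘ π) x * qv (f ∘ q) u) (n' : ℕ) :
    ∀ (s : Fin n' → F) {k : ℕ} (r : Fin k → F), (∀ i, r i ≠ 0) →
      Isom (Sum.elim (tensorQF π r) s) q →
      ∃ (k : ℕ) (r : Fin k → F), (∀ i, r i ≠ 0) ∧ Isom q (tensorQF π r) := by
  induction n' using Nat.strong_induction_on with
  | _ n' ih =>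
  intro s k r hr hs
  cases n' with
  | zero =>
    refine ⟨k, r, hr, hs.symm.trans (Isom.of_equiv (Equiv.sumEmpty _ _) ?_)⟩
    rintro (i | i)
    · rfl
    · exact i.elim0
  | succ l =>
    have hs0 : s 0 ≠ 0 := (hs.aniso hq).right.ne_zero 0
    let r' : Fin (k + 1) → F := Fin.cons (s 0) r
    have hr' : ∀ i, r' i ≠ 0 := fun i => Fin.cases hs0 hr i
    obtain ⟨l', s', hs'⟩ := isom_of_forall_exists_qv_eq h2 (d := tensorQF π r') (q := q)
      (fun i => mul_ne_zero (hπ _) (hr' _)) hq (by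
        intro L _ f hf x
        have hsL := hs.map h2 f
        rw [Sum.comp_elim, comp_tensorQF] at hsL
        rw [comp_tensorQF, qv_tensorQF, Fin.sum_univ_succ]
        simp only [Function.comp_apply, r', Fin.cons_zero, Fin.cons_succ]
        set x₀ : Fin m → L := fun i => x (finProdFinEquiv (i, 0))
        by_cases ht : qv (f ∘ π) x₀ = 0
        · obtain ⟨y, hy⟩ := hsL.exists_qv_eq (Sum.elim (fun ij =>
            x (finProdFinEquiv ((finProdFinEquiv.symm ij).1, (finProdFinEquiv.symm ij).2.succ))) 0)
          refine ⟨y, hy.trans ?_⟩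
          rw [qv_sum_elim, ht, mul_zero, zero_add, Sum.elim_comp_inl, Sum.elim_comp_inr, qv_zero,
            add_zero, qv_tensorQF]
          simp
        · obtain ⟨U, hU⟩ := hround L f x₀ ht
          set t := qv (f ∘ π) x₀
          obtain ⟨u, hu⟩ := hsL.exists_qv_eq (Sum.elim (fun ij =>
            (t⁻¹ • U fun i => x (finProdFinEquiv (i, (finProdFinEquiv.symm ij).2.succ)))
              (finProdFinEquiv.symm ij).1) (Pi.single 0 1))
          obtain ⟨y, hy⟩ := hmul L f hf x₀ u
          refine ⟨y, hy.trans ?_⟩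
          rw [hu, qv_sum_elim, Sum.elim_comp_inl, Sum.elim_comp_inr, qv_tensorQF,
            qv_single]
          simp only [Equiv.symm_apply_apply, Function.comp_apply]
          rw [mul_add, add_comm, mul_comm t, Finset.mul_sum]
          congr 1
          refine Finset.sum_congr rfl fun j _ => ?_
          have h5 := qv_smul (f ∘ π) t⁻¹ (U fun i => x (finProdFinEquiv (i, j.succ)))
          rw [hU] at h5
          change t * (f (r j) * qv (f ∘ π) (t⁻¹ • U fun i => x (finProdFinEquiv (i, j.succ)))) = _
          rw [h5]
          field_simp)
    refine ih l' ?_ s' r' hr' hs'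
    obtain ⟨φ, -⟩ := hs.trans hs'.symm
    have hcard := card_eq_of_linearEquiv F φ
    simp only [Fintype.card_sum, Fintype.card_fin, mul_add] at hcard
    omega

end Assembly

theorem Anisotropic.aniso {F : Type*} [Field F] {n : ℕ} {d : Fin n → F} (h : Anisotropic d) :
    Aniso d := by
  intro v hv
  by_contra h0
  exact h ⟨v, h0, hv⟩

theorem Subform.exists_linearMap {F : Type*} [Field F] {m n : ℕ} {r : Fin m → F} {d : Fin n → F}
    (h : Subform r d) : ∃ P : (Fin m → F) →ₗ[F] (Fin n → F), ∀ v, qv d (P v) = qv r v := by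
  obtain ⟨k, s, -, φ, hφ⟩ := h
  let D : (Fin m → F) →ₗ[F] (Fin (m + k) → F) :=
    LinearMap.pi (Fin.addCases (fun i => LinearMap.proj i) fun _ => 0)
  refine ⟨φ.symm.toLinearMap ∘ₗ D, fun v => ?_⟩
  have h1 := hφ (φ.symm (D v))
  rw [φ.apply_symm_apply] at h1
  refine h1.symm.trans ?_
  rw [evalQF, Fin.sum_univ_add]
  simp only [osum, D, LinearMap.pi_apply, Fin.append_left, Fin.append_right, Fin.addCases_left,
    Fin.addCases_right, LinearMap.proj_apply, LinearMap.zero_apply]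
  simp [qv]

end QF

open QF in
/-- Arason–Pfister/Elman–Lam: let `p`, `q` be anisotropic forms over `F` (char `F ≠ 2`), with
`p` a neighbour of a Pfister form `π` (i.e. `p` is similar to a subform of `π` and
`dim p > (dim π)/2`). If `q` becomes hyperbolic over `F(p)`, then `q ≅ π ⊗ r` for some form
`r` over `F`. -/
theorem stmt_17 {F : Type*} [Field F] (h2 : (2 : F) ≠ 0)
    {np nq mπ : ℕ} (p : Fin np → F) (q : Fin nq → F) (π : Fin mπ → F)
    (hp : Nondeg p) (hq : Nondeg q) (hp0 : 0 < np) (hq0 : 0 < nq)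
    (hpan : Anisotropic p) (hqan : Anisotropic q)
    (hπ : IsPfister π)
    (hnbr : ∃ c : F, c ≠ 0 ∧ Subform (smulQF c p) π)
    (hdim : mπ < 2 * np)
    (hhyp : IsHyperbolic (bc (algebraMap F (FunField p)) q)) :
    ∃ (k : ℕ) (r : Fin k → F), Nondeg r ∧ Isometric q (tensorQF π r) := by
  obtain ⟨m, rfl⟩ := Nat.exists_eq_succ_of_ne_zero hp0.ne'
  obtain ⟨c, hc, hsub⟩ := hnbr
  obtain ⟨P, hP⟩ := hsub.exists_linearMap
  have : IsEmpty (Fin (mπ * 0)) := ⟨fun i => (finProdFinEquiv.symm i).2.elim0⟩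
  refine exists_isom_tensorQF h2 hπ.pos (hπ.ne_zero h2) hqan.aniso
    (fun L _ f => hπ.round h2 f) (fun L _ f hf x u => ?_) nq q (k := 0) Fin.elim0
    (fun i => i.elim0) (Isom.of_equiv (Equiv.emptySum _ _) ?_)
  · have h2L : (2 : L) ≠ 0 := by
      have := (map_ne_zero f).mpr h2
      rwa [map_ofNat] at this
    refine exists_qv_eq_mul_of_neighbour (p := f ∘ p) (hf _ p hpan.aniso) (hπ.round h2 f)
      ((map_ne_zero f).mpr hc) ((map_ne_zero f).mpr (hp 0)) (bcMap f P) (fun v => ?_) hdim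
      (fun v u => ?_) x u
    · rw [qv_bcMap h2L f P hP v]
      simp [qv, smulQF, Finset.mul_sum, mul_assoc]
    · rcases Nat.eq_zero_or_pos m with rfl | hm
      · refine ⟨(f (p 0) * v 0) • u, ?_⟩
        have h1 : qv (f ∘ p) v = f (p 0) * v 0 ^ 2 := Fin.sum_univ_one _
        rw [qv_smul, h1]
        ring
      · exact exists_qv_eq_of_hyperbolic h2 hm (hp 0) hpan.aniso hqan.aniso hhyp f
          (hf _ q hqan.aniso) v u
  · rintro (i | i)
    · exact isEmptyElim i
    · rfl
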